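/- For real parameters μ, ν > (p̃−1)/2 and integers p̃ ≥ q ≥ 1, let β_{p̃;μ,ν} be the probability measure on Π_{p̃}^I with density det(y)^{μ−(p̃+1)/2} det(I−y)^{ν−(p̃+1)/2} / B_Ω^{p̃}(μ,ν), and let P : Π_{p̃}^I → Π_q^I send a matrix to its upper-left q×q block. Then the pushforward of β_{p̃;μ,ν} under P equals β_{q;μ,ν}. -/

import Mathlib

open Matrix MeasureTheory

/-- Index of the upper-triangular coordinates of a symmetric `m×m` matrix. -/
abbrev SymIdx (m : ℕ) := {p : Fin m × Fin m // p.1 ≤ p.2}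

/-- The symmetric matrix with the given upper-triangular coordinates. -/
noncomputable def toSym (m : ℕ) (c : SymIdx m → ℝ) : Matrix (Fin m) (Fin m) ℝ :=
  fun i j => if h : i ≤ j then c ⟨(i, j), h⟩ else c ⟨(j, i), (not_le.mp h).le⟩

noncomputable instance matrixMeasureSpace (m : ℕ) :
    MeasureSpace (Matrix (Fin m) (Fin m) ℝ) :=
  inferInstanceAs (MeasureSpace (Fin m → Fin m → ℝ))

/-- Lebesgue measure on the space of real symmetric `m×m` matrices. -/
noncomputable def symMeasure (m : ℕ) : Measure (Matrix (Fin m) (Fin m) ℝ) :=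
  Measure.map (toSym m) volume

/-- The gamma function of the cone of positive definite real symmetric `m×m` matrices. -/
noncomputable def GammaOmegaR (m : ℕ) (μ : ℝ) : ℝ :=
  Real.pi ^ (((m * (m - 1) : ℕ) : ℝ) / 4) *
    ∏ j ∈ Finset.range m, Real.Gamma (μ - (j : ℝ) / 2)

/-- The matrix beta normalizing constant `B_Ω^m(μ,ν)`. -/
noncomputable def BOmega (m : ℕ) (μ ν : ℝ) : ℝ :=
  GammaOmegaR m μ * GammaOmegaR m ν / GammaOmegaR m (μ + ν)

/-- The matrix beta distribution `β_{m;μ,ν}` on `Π_m^I = {0 ≤ y ≤ I}`, with density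
`det(y)^{μ−(m+1)/2} det(I−y)^{ν−(m+1)/2} / B_Ω^m(μ,ν)` w.r.t. Lebesgue measure on
symmetric matrices. -/
noncomputable def betaMeasure (m : ℕ) (μ ν : ℝ) : Measure (Matrix (Fin m) (Fin m) ℝ) :=
  ((symMeasure m).restrict
      {y : Matrix (Fin m) (Fin m) ℝ | y.PosSemidef ∧ (1 - y).PosSemidef}).withDensity
    (fun y => ENNReal.ofReal
      (y.det ^ (μ - ((m : ℝ) + 1) / 2) * (1 - y).det ^ (ν - ((m : ℝ) + 1) / 2) /
        BOmega m μ ν))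


/-- The truncated power `x₊ ^ s`, vanishing for `x ≤ 0`, with values in `ℝ≥0∞`. -/
noncomputable def truncPow (s x : ℝ) : ENNReal := if 0 < x then ENNReal.ofReal (x ^ s) else 0

lemma truncPow_of_pos {s x : ℝ} (hx : 0 < x) : truncPow s x = ENNReal.ofReal (x ^ s) := if_pos hx

lemma truncPow_of_nonpos {s x : ℝ} (hx : x ≤ 0) : truncPow s x = 0 := if_neg hx.not_gt

lemma measurable_truncPow (s : ℝ) : Measurable (truncPow s) :=
  Measurable.ite measurableSet_Ioi (by fun_prop) measurable_const

lemma truncPow_mul {s x y : ℝ} (hx : 0 < x) :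
    truncPow s (x * y) = ENNReal.ofReal (x ^ s) * truncPow s y := by
  rcases lt_or_ge 0 y with hy | hy
  · rw [truncPow_of_pos (mul_pos hx hy), truncPow_of_pos hy, Real.mul_rpow hx.le hy.le,
      ENNReal.ofReal_mul (by positivity)]
  · rw [truncPow_of_nonpos hy, mul_zero,
      truncPow_of_nonpos (mul_nonpos_of_nonneg_of_nonpos hx.le hy)]

lemma truncPow_mul_truncPow_one_sub {α β : ℝ} (hα : 0 < α + 1) (hβ : 0 < β + 1) (u : ℝ) :
    truncPow α u * truncPow β (1 - u) =
      ENNReal.ofReal (ProbabilityTheory.beta (α + 1) (β + 1)) *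
        ProbabilityTheory.betaPDF (α + 1) (β + 1) u := by
  have hB := ProbabilityTheory.beta_pos hα hβ
  rcases le_or_gt u 0 with h | h
  · rw [truncPow_of_nonpos h, ProbabilityTheory.betaPDF_eq_zero_of_nonpos h]; simp
  rcases le_or_gt 1 u with h' | h'
  · rw [truncPow_of_nonpos (sub_nonpos.2 h'), ProbabilityTheory.betaPDF_eq_zero_of_one_le h']; simp
  · rw [truncPow_of_pos h, truncPow_of_pos (sub_pos.2 h'),
      ProbabilityTheory.betaPDF_of_pos_lt_one h h', ← ENNReal.ofReal_mul (by positivity),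
      ← ENNReal.ofReal_mul hB.le]
    congr 1
    simp only [add_sub_cancel_right]
    field_simp

lemma lintegral_truncPow_mul_truncPow {α β : ℝ} (hα : 0 < α + 1) (hβ : 0 < β + 1) (a c : ℝ) :
    ∫⁻ d, truncPow α (d - a) * truncPow β (c - d) =
      ENNReal.ofReal (ProbabilityTheory.beta (α + 1) (β + 1)) * truncPow (α + β + 1) (c - a) := by
  rcases le_or_gt c a with h | h
  · rw [truncPow_of_nonpos (sub_nonpos.2 h), mul_zero, lintegral_eq_zero_iff' (by
      have := measurable_truncPow
      fun_prop)]
    refine .of_forall fun d => ?_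
    rcases le_or_gt d a with h' | h'
    · simp [truncPow_of_nonpos (sub_nonpos.2 h')]
    · simp [truncPow_of_nonpos (sub_nonpos.2 (h.trans h'.le))]
  · have hL : 0 < c - a := sub_pos.2 h
    have m1 := measurable_truncPow α
    have m2 := measurable_truncPow β
    rw [← lintegral_add_right_eq_self _ a, ← Real.smul_map_volume_mul_left hL.ne',
      lintegral_smul_measure, lintegral_map (by fun_prop) (by fun_prop)]
    have key : ∀ u : ℝ, truncPow α ((c - a) * u + a - a) * truncPow β (c - ((c - a) * u + a)) =
        ENNReal.ofReal ((c - a) ^ α * (c - a) ^ β *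
          ProbabilityTheory.beta (α + 1) (β + 1)) *
          ProbabilityTheory.betaPDF (α + 1) (β + 1) u := by
      intro u
      rw [add_sub_cancel_right, show c - ((c - a) * u + a) = (c - a) * (1 - u) by ring,
        truncPow_mul hL, truncPow_mul hL, mul_mul_mul_comm, truncPow_mul_truncPow_one_sub hα hβ,
        ENNReal.ofReal_mul (by positivity), ENNReal.ofReal_mul (by positivity)]
      ring
    simp_rw [key]
    have mB : Measurable (ProbabilityTheory.betaPDF (α + 1) (β + 1)) :=
      (ProbabilityTheory.measurable_betaPDFReal _ _).ennreal_ofReal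
    rw [lintegral_const_mul _ mB,
      ProbabilityTheory.lintegral_betaPDF_eq_one hα hβ, truncPow_of_pos hL, mul_one, smul_eq_mul,
      ← ENNReal.ofReal_mul (abs_nonneg _), ← ENNReal.ofReal_mul (ProbabilityTheory.beta_pos hα hβ).le,
      abs_of_pos hL, Real.rpow_add hL, Real.rpow_add hL, Real.rpow_one]
    congr 1
    ring

lemma beta_self_mul_two_rpow {s : ℝ} (hs : 0 < s) :
    ProbabilityTheory.beta s s * 2 ^ (2 * s - 1) =
      √Real.pi * Real.Gamma s / Real.Gamma (s + 1 / 2) := by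
  have h := Real.Gamma_mul_Gamma_add_half s
  have h1 : Real.Gamma (s + 1 / 2) ≠ 0 := (Real.Gamma_pos_of_pos (by linarith)).ne'
  have h2 : Real.Gamma (2 * s) ≠ 0 := (Real.Gamma_pos_of_pos (by linarith)).ne'
  rw [show 1 - 2 * s = -(2 * s - 1) by ring, Real.rpow_neg two_pos.le] at h
  rw [ProbabilityTheory.beta, ← two_mul]
  field_simp at h ⊢
  linarith

lemma lintegral_truncPow_sub_sq {s : ℝ} (hs : 0 < s + 1) (r : ℝ) :
    ∫⁻ t, truncPow s (r - t ^ 2) =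
      ENNReal.ofReal (√Real.pi * Real.Gamma (s + 1) / Real.Gamma (s + 1 + 1 / 2)) *
        truncPow (s + 1 / 2) r := by
  rcases le_or_gt r 0 with h | h
  · rw [truncPow_of_nonpos h, mul_zero]
    have (t : ℝ) : truncPow s (r - t ^ 2) = 0 := truncPow_of_nonpos (by nlinarith [sq_nonneg t])
    simp [this]
  · have hr : 0 < √r := Real.sqrt_pos.2 h
    have key (t : ℝ) : truncPow s (r - t ^ 2) = truncPow s (t - -√r) * truncPow s (√r - t) := by
      have e : r - t ^ 2 = (t - -√r) * (√r - t) := by linear_combination - Real.sq_sqrt h.le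
      rcases lt_or_ge 0 (t - -√r) with h1 | h1
      · rw [e, truncPow_mul h1, truncPow_of_pos h1]
      · rw [truncPow_of_nonpos h1, zero_mul, e, truncPow_of_nonpos]
        exact mul_nonpos_of_nonpos_of_nonneg h1 (by linarith)
    simp_rw [key]
    rw [lintegral_truncPow_mul_truncPow hs hs, truncPow_of_pos (by linarith), truncPow_of_pos h,
      ← beta_self_mul_two_rpow hs, ← ENNReal.ofReal_mul (ProbabilityTheory.beta_pos hs hs).le,
      ← ENNReal.ofReal_mul (mul_nonneg (ProbabilityTheory.beta_pos hs hs).le (by positivity)),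
      mul_assoc]
    congr 2
    rw [sub_neg_eq_add, ← two_mul, Real.mul_rpow two_pos.le hr.le, Real.sqrt_eq_rpow,
      ← Real.rpow_mul h.le]
    congr 2 <;> ring

lemma lintegral_truncPow_sub_sum_sq (m : ℕ) {s : ℝ} (hs : 0 < s + 1) (r : ℝ) :
    ∫⁻ b : Fin m → ℝ, truncPow s (r - ∑ i, b i ^ 2) =
      ENNReal.ofReal (Real.pi ^ ((m : ℝ) / 2) * Real.Gamma (s + 1) / Real.Gamma (s + 1 + m / 2)) *
        truncPow (s + m / 2) r := by
  have hG := (Real.Gamma_pos_of_pos hs).ne'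
  have mG := measurable_truncPow
  induction m generalizing r with
  | zero => simp [hG, volume_pi]
  | succ n ih =>
    rw [← (volume_preserving_piFinSuccAbove (fun _ : Fin (n + 1) => ℝ) 0).symm.lintegral_comp
      (by fun_prop), Measure.volume_eq_prod, lintegral_prod _ (by
        refine Measurable.aemeasurable ?_
        refine (Measurable.comp (g := fun b : Fin (n + 1) → ℝ => truncPow s (r - ∑ i, b i ^ 2)) ?_
          (MeasurableEquiv.measurable _))
        fun_prop)]
    have e (x : ℝ) (y : Fin n → ℝ) :
        r - ∑ i, ((MeasurableEquiv.piFinSuccAbove (fun _ : Fin (n + 1) => ℝ) 0).symm (x, y)) i ^ 2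
          = (r - x ^ 2) - ∑ i, y i ^ 2 := by
      simp [MeasurableEquiv.piFinSuccAbove, Fin.sum_univ_succ]
      ring
    simp_rw [e, ih]
    have hn : 0 < s + n / 2 + 1 := by linarith [Nat.cast_nonneg (α := ℝ) n]
    have hG1 := Real.Gamma_pos_of_pos hs
    have hG2 := Real.Gamma_pos_of_pos hn
    rw [show s + 1 + (n : ℝ) / 2 = s + n / 2 + 1 by ring]
    rw [lintegral_const_mul _ (by fun_prop), lintegral_truncPow_sub_sq hn, ← mul_assoc,
      ← ENNReal.ofReal_mul (by positivity)]
    congr 2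
    · rw [show s + 1 + ((n + 1 : ℕ) : ℝ) / 2 = s + n / 2 + 1 + 1 / 2 by push_cast; ring,
        show ((n + 1 : ℕ) : ℝ) / 2 = n / 2 + 1 / 2 by push_cast; ring,
        Real.rpow_add Real.pi_pos, ← Real.sqrt_eq_rpow]
      generalize Real.Gamma (s + n / 2 + 1) = g at *
      field_simp
    · push_cast
      ring

section Ellipsoid

open scoped MatrixOrder

lemma lintegral_truncPow_sub_quadratic {m : ℕ} {K : Matrix (Fin m) (Fin m) ℝ} (hK : K.PosDef)
    {s : ℝ} (hs : 0 < s + 1) (r : ℝ) :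
    ∫⁻ b : Fin m → ℝ, truncPow s (r - b ⬝ᵥ K *ᵥ b) =
      ENNReal.ofReal ((√K.det)⁻¹ * (Real.pi ^ ((m : ℝ) / 2) * Real.Gamma (s + 1) /
        Real.Gamma (s + 1 + m / 2))) * truncPow (s + m / 2) r := by
  have mG := measurable_truncPow s
  have hM : (CFC.sqrt K).IsHermitian := (CFC.sqrt_nonneg K).posSemidef.isHermitian
  have hMM : CFC.sqrt K * CFC.sqrt K = K := CFC.sqrt_mul_sqrt_self K hK.posSemidef.nonneg
  have hdet : (CFC.sqrt K).det = √K.det := by simpa using hK.posSemidef.det_sqrt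
  generalize CFC.sqrt K = M at hM hMM hdet
  have hpos : 0 < √K.det := Real.sqrt_pos.2 hK.det_pos
  have key (b : Fin m → ℝ) : b ⬝ᵥ K *ᵥ b = ∑ i, (toLin' M b) i ^ 2 := by
    have hT : b ᵥ* M = M *ᵥ b := by
      rw [← mulVec_transpose, ← conjTranspose_eq_transpose_of_trivial, hM.eq]
    rw [← hMM, ← mulVec_mulVec, dotProduct_mulVec, hT, toLin'_apply]
    simp [dotProduct, sq]
  simp_rw [key]
  rw [← lintegral_map (f := fun b : Fin m → ℝ => truncPow s (r - ∑ i, b i ^ 2)) (by fun_prop)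
      (LinearMap.continuous_of_finiteDimensional _).measurable,
    Real.map_matrix_volume_pi_eq_smul_volume_pi (hdet ▸ hpos.ne'), lintegral_smul_measure,
    lintegral_truncPow_sub_sum_sq m hs, hdet, abs_of_pos (inv_pos.2 hpos), smul_eq_mul, ← mul_assoc,
    ← ENNReal.ofReal_mul (inv_pos.2 hpos).le]

end Ellipsoid

section Border

variable {n : Type*} [Fintype n] [DecidableEq n]

/-- The matrix `A` bordered by the vector `b` and the corner entry `d`. -/
def border (A : Matrix n n ℝ) (b : n → ℝ) (d : ℝ) : Matrix (n ⊕ Unit) (n ⊕ Unit) ℝ :=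
  fromBlocks A (replicateCol Unit b) (replicateRow Unit b) (of fun _ _ => d)

omit [Fintype n] in
lemma one_sub_border (A : Matrix n n ℝ) (b : n → ℝ) (d : ℝ) :
    1 - border A b d = border (1 - A) (-b) (1 - d) := by
  ext (i | i) (j | j) <;> simp [border, one_apply]

omit [Fintype n] [DecidableEq n] in
lemma border_submatrix_inl (A : Matrix n n ℝ) (b : n → ℝ) (d : ℝ) :
    (border A b d).submatrix Sum.inl Sum.inl = A := rfl

lemma schur_complement_border (A : Matrix n n ℝ) (b : n → ℝ) (d : ℝ) :
    (of fun _ _ => d : Matrix Unit Unit ℝ) - replicateRow Unit b * A⁻¹ * replicateCol Unit b =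
      of fun _ _ => d - b ⬝ᵥ A⁻¹ *ᵥ b := by
  ext i j
  rw [Matrix.mul_assoc, ← replicateCol_mulVec]
  simp [Matrix.mul_apply, dotProduct]

lemma det_border {A : Matrix n n ℝ} (hA : A.PosDef) (b : n → ℝ) (d : ℝ) :
    (border A b d).det = A.det * (d - b ⬝ᵥ A⁻¹ *ᵥ b) := by
  have := hA.isUnit.invertible
  rw [border, det_fromBlocks₁₁, invOf_eq_nonsing_inv, schur_complement_border]
  simp

lemma posSemidef_border {A : Matrix n n ℝ} (hA : A.PosDef) (b : n → ℝ) (d : ℝ) :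
    (border A b d).PosSemidef ↔ 0 ≤ d - b ⬝ᵥ A⁻¹ *ᵥ b := by
  have := hA.isUnit.invertible
  have h := PosDef.fromBlocks₁₁ (replicateCol Unit b) (of fun _ _ => d) hA
  rw [conjTranspose_replicateCol, star_trivial, schur_complement_border] at h
  rw [border, h]
  have e : (of fun _ _ => d - b ⬝ᵥ A⁻¹ *ᵥ b : Matrix Unit Unit ℝ) =
      diagonal fun _ => d - b ⬝ᵥ A⁻¹ *ᵥ b := by
    ext; simp
  rw [e, posSemidef_diagonal_iff]
  simp

omit [Fintype n] [DecidableEq n] in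
lemma continuous_border {X : Type*} [TopologicalSpace X] {A : X → Matrix n n ℝ} {b : X → n → ℝ}
    {d : X → ℝ} (hA : Continuous A) (hb : Continuous b) (hd : Continuous d) :
    Continuous fun x => border (A x) (b x) (d x) :=
  hA.matrix_fromBlocks hb.matrix_replicateCol hb.matrix_replicateRow
    (continuous_matrix fun _ _ => hd)

end Border

section Weight

variable {n k : Type*} [Fintype n] [DecidableEq n] [Fintype k] [DecidableEq k]

/-- The function `det(y)^α det(I−y)^β / B` on `{0 ≤ y ≤ I}`, extended by zero. -/
noncomputable def betaWeight (α β B : ℝ) (y : Matrix n n ℝ) : ENNReal :=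
  {y : Matrix n n ℝ | y.PosSemidef ∧ (1 - y).PosSemidef}.indicator
    (fun y => ENNReal.ofReal (y.det ^ α * (1 - y).det ^ β / B)) y

omit [DecidableEq n] in
lemma isClosed_setOf_posSemidef : IsClosed {y : Matrix n n ℝ | y.PosSemidef} := by
  simp_rw [posSemidef_iff_dotProduct_mulVec, Set.ofPred_and, Set.ofPred_forall]
  refine IsClosed.inter (isClosed_eq (by fun_prop) continuous_id)
    (isClosed_iInter fun x => isClosed_le continuous_const (by fun_prop))

lemma isClosed_setOf_posSemidef_and_one_sub :
    IsClosed {y : Matrix n n ℝ | y.PosSemidef ∧ (1 - y).PosSemidef} :=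
  isClosed_setOf_posSemidef.inter (isClosed_setOf_posSemidef.preimage (by fun_prop))

lemma measurable_betaWeight_comp {X : Type*} [TopologicalSpace X] [MeasurableSpace X]
    [OpensMeasurableSpace X] (α β B : ℝ) {Y : X → Matrix n n ℝ} (hY : Continuous Y) :
    Measurable fun x => betaWeight α β B (Y x) := by
  have h1 : Measurable fun x => (Y x).det := hY.matrix_det.measurable
  have h2 : Measurable fun x => (1 - Y x).det := (continuous_const.sub hY).matrix_det.measurable
  exact Measurable.indicator (f := fun x => ENNReal.ofReal ((Y x).det ^ α * (1 - Y x).det ^ β / B))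
    (by fun_prop) (isClosed_setOf_posSemidef_and_one_sub.preimage hY).measurableSet

lemma betaWeight_submatrix_equiv (α β B : ℝ) (y : Matrix n n ℝ) (e : k ≃ n) :
    betaWeight α β B (y.submatrix e e) = betaWeight α β B y := by
  have h : 1 - y.submatrix e e = (1 - y).submatrix e e := by simp [submatrix_sub]
  have hmem : y.submatrix e e ∈ {y : Matrix k k ℝ | y.PosSemidef ∧ (1 - y).PosSemidef} ↔
      y.PosSemidef ∧ (1 - y).PosSemidef := by
    rw [Set.mem_ofPred_eq, h, posSemidef_submatrix_equiv, posSemidef_submatrix_equiv]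
  by_cases hy : y.PosSemidef ∧ (1 - y).PosSemidef
  · rw [betaWeight, betaWeight, Set.indicator_of_mem (hmem.2 hy),
      Set.indicator_of_mem (by exact hy), h,
      det_submatrix_equiv_self, det_submatrix_equiv_self]
  · rw [betaWeight, betaWeight, Set.indicator_of_notMem (mt hmem.1 hy),
      Set.indicator_of_notMem (by exact hy)]

lemma betaWeight_border {A : Matrix n n ℝ} (hA : A.PosDef) (hA' : (1 - A).PosDef)
    {α β B : ℝ} (hB : 0 < B) {b : n → ℝ} {d : ℝ}
    (h : d ≠ b ⬝ᵥ A⁻¹ *ᵥ b) (h' : d ≠ 1 - b ⬝ᵥ (1 - A)⁻¹ *ᵥ b) :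
    betaWeight α β B (border A b d) =
      ENNReal.ofReal (A.det ^ α * (1 - A).det ^ β / B) *
        (truncPow α (d - b ⬝ᵥ A⁻¹ *ᵥ b) * truncPow β (1 - b ⬝ᵥ (1 - A)⁻¹ *ᵥ b - d)) := by
  have e : 1 - d - -b ⬝ᵥ (1 - A)⁻¹ *ᵥ -b = 1 - b ⬝ᵥ (1 - A)⁻¹ *ᵥ b - d := by
    simp [mulVec_neg]; ring
  have hd := hA.det_pos
  have hd' := hA'.det_pos
  simp only [betaWeight, Set.indicator, Set.mem_ofPred_eq, one_sub_border, posSemidef_border hA,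
    posSemidef_border hA', det_border hA, det_border hA', e]
  rcases lt_or_gt_of_ne h with h | h
  · rw [if_neg (by intro H; linarith [H.1]), truncPow_of_nonpos (by linarith)]; simp
  rcases lt_or_gt_of_ne h' with h' | h'
  · have h0 := sub_pos.2 h
    have h0' := sub_pos.2 h'
    rw [if_pos ⟨h0.le, h0'.le⟩, truncPow_of_pos h0, truncPow_of_pos h0',
      ← ENNReal.ofReal_mul (by positivity), ← ENNReal.ofReal_mul (by positivity),
      Real.mul_rpow hd.le h0.le, Real.mul_rpow hd'.le h0'.le]
    congr 1
    ring
  · rw [if_neg (by intro H; linarith [H.2]),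
      truncPow_of_nonpos (x := 1 - b ⬝ᵥ (1 - A)⁻¹ *ᵥ b - d) (by linarith)]
    simp

lemma posDef_inv_add_inv {A : Matrix n n ℝ} (hA : A.PosDef) (hA' : (1 - A).PosDef) :
    (A⁻¹ + (1 - A)⁻¹).PosDef := hA.inv.add hA'.inv

lemma det_inv_add_inv_one_sub {A : Matrix n n ℝ} (hA : A.PosDef) (hA' : (1 - A).PosDef) :
    (A⁻¹ + (1 - A)⁻¹).det = (A.det * (1 - A).det)⁻¹ := by
  have h : A * (A⁻¹ + (1 - A)⁻¹) * (1 - A) = 1 := by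
    rw [mul_add, add_mul, mul_nonsing_inv _ hA.det_pos.ne'.isUnit, mul_assoc,
      nonsing_inv_mul _ hA'.det_pos.ne'.isUnit]
    simp
  have h2 := congrArg det h
  rw [det_mul, det_mul, det_one] at h2
  refine eq_inv_of_mul_eq_one_left ?_
  linarith

end Weight

section Coordinates

lemma continuous_toSym (m : ℕ) : Continuous (toSym m) := by
  refine continuous_matrix fun i j => ?_
  unfold toSym
  split_ifs <;> fun_prop

lemma toSym_add_smul_one (m : ℕ) (c : SymIdx m → ℝ) (t : ℝ) :
    toSym m (c + t • fun p => (1 : Matrix (Fin m) (Fin m) ℝ) p.1.1 p.1.2) =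
      toSym m c + t • (1 : Matrix (Fin m) (Fin m) ℝ) := by
  ext i j
  by_cases h : i ≤ j
  · simp [toSym, h]
  · simp [toSym, h, one_apply, eq_comm]

lemma ae_det_smul_one_sub_ne_zero {m : ℕ} (M : Matrix (Fin m) (Fin m) ℝ) :
    ∀ᵐ t : ℝ, (t • (1 : Matrix (Fin m) (Fin m) ℝ) - M).det ≠ 0 := by
  have h : {t : ℝ | ¬ (t • (1 : Matrix (Fin m) (Fin m) ℝ) - M).det ≠ 0} ⊆
      M.charpoly.rootSet ℝ := by
    intro t ht
    rw [Polynomial.mem_rootSet_of_ne M.charpoly_monic.ne_zero]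
    simpa [eval_charpoly, ← smul_one_eq_diagonal, scalar_apply] using ht
  exact measure_mono_null h ((Polynomial.rootSet_finite _ _).measure_zero _)

lemma ae_det_toSym_ne_zero (m : ℕ) :
    ∀ᵐ c : SymIdx m → ℝ, (toSym m c).det ≠ 0 ∧ (1 - toSym m c).det ≠ 0 := by
  have hc := continuous_toSym m
  have hopen : IsOpen {c : SymIdx m → ℝ | (toSym m c).det ≠ 0 ∧ (1 - toSym m c).det ≠ 0} :=
    (isOpen_ne_fun hc.matrix_det continuous_const).inter
      (isOpen_ne_fun (continuous_const.sub hc).matrix_det continuous_const)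
  refine ae_mem_of_ae_add_linearMap_mem (𝕜 := ℝ) (LinearMap.toSpanSingleton ℝ (SymIdx m → ℝ)
    fun p => (1 : Matrix (Fin m) (Fin m) ℝ) p.1.1 p.1.2) volume volume hopen.measurableSet
    fun c => ?_
  filter_upwards [ae_det_smul_one_sub_ne_zero (-toSym m c),
    ae_det_smul_one_sub_ne_zero (1 - toSym m c)] with t h1 h2
  change (toSym m _).det ≠ 0 ∧ (1 - toSym m _).det ≠ 0
  rw [LinearMap.toSpanSingleton_apply, toSym_add_smul_one]
  constructor
  · rwa [sub_neg_eq_add, add_comm] at h1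
  · rw [← neg_sub, det_neg] at h2
    rw [← sub_sub]
    exact right_ne_zero_of_mul h2

/-- Upper-triangular positions of a matrix of size `m + 1`: those of its upper-left corner of
size `m`, and those of the last column. -/
def symIdxSum (m : ℕ) : SymIdx m ⊕ (Fin m ⊕ Unit) → SymIdx (m + 1)
  | .inl p => ⟨(p.1.1.castSucc, p.1.2.castSucc), Fin.castSucc_le_castSucc_iff.2 p.2⟩
  | .inr (.inl i) => ⟨(i.castSucc, Fin.last m), Fin.le_last _⟩
  | .inr (.inr _) => ⟨(Fin.last m, Fin.last m), le_rfl⟩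

lemma symIdxSum_bijective (m : ℕ) : Function.Bijective (symIdxSum m) := by
  constructor
  · rintro (⟨⟨i, j⟩, h⟩ | i | _) (⟨⟨i', j'⟩, h'⟩ | i' | _) H <;>
      simp_all [symIdxSum, (Fin.castSucc_lt_last _).ne, (Fin.castSucc_lt_last _).ne']
  · rintro ⟨⟨i, j⟩, h⟩
    induction j using Fin.lastCases with
    | last =>
      induction i using Fin.lastCases with
      | last => exact ⟨.inr (.inr ()), rfl⟩
      | cast i => exact ⟨.inr (.inl i), rfl⟩
    | cast j =>
      induction i using Fin.lastCases with
      | last => exact absurd h (Fin.castSucc_lt_last j).not_ge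
      | cast i => exact ⟨.inl ⟨(i, j), Fin.castSucc_le_castSucc_iff.1 h⟩, rfl⟩

/-- Coordinates of the upper-left corner, of the last column without its last entry, and of the
last diagonal entry. -/
def splitCoords (m : ℕ) (c : SymIdx (m + 1) → ℝ) : (SymIdx m → ℝ) × ((Fin m → ℝ) × ℝ) :=
  (fun p => c (symIdxSum m (.inl p)), fun i => c (symIdxSum m (.inr (.inl i))),
    c (symIdxSum m (.inr (.inr ()))))

lemma measurePreserving_splitCoords (m : ℕ) : MeasurePreserving (splitCoords m) := by
  let e := Equiv.ofBijective _ (symIdxSum_bijective m)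
  have h1 := (volume_measurePreserving_piCongrLeft (fun _ : SymIdx (m + 1) => ℝ) e).symm
  have h2 := volume_measurePreserving_sumPiEquivProdPi
    (fun _ : SymIdx m ⊕ (Fin m ⊕ Unit) => ℝ)
  have h3 := volume_measurePreserving_sumPiEquivProdPi (fun _ : Fin m ⊕ Unit => ℝ)
  have h4 := volume_preserving_funUnique Unit ℝ
  exact ((MeasurePreserving.id volume).prod
    (((MeasurePreserving.id volume).prod h4).comp h3)).comp (h2.comp h1)

/-- Append one index to `Fin m`, in last position. -/
def finSumUnitEquiv (m : ℕ) : Fin m ⊕ Unit ≃ Fin (m + 1) :=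
  (Equiv.optionEquivSumPUnit (Fin m)).symm.trans finSuccEquivLast.symm

lemma toSym_succ_submatrix (m : ℕ) (c : SymIdx (m + 1) → ℝ) :
    (toSym (m + 1) c).submatrix (finSumUnitEquiv m) (finSumUnitEquiv m) =
      border (toSym m (splitCoords m c).1) (splitCoords m c).2.1 (splitCoords m c).2.2 := by
  ext (i | i) (j | j) <;>
    simp [finSumUnitEquiv, toSym, border, splitCoords, symIdxSum, Fin.le_last,
      Fin.castSucc_le_castSucc_iff, (Fin.castSucc_lt_last _).not_ge]

end Coordinates

section Measure

instance (m : ℕ) : BorelSpace (Matrix (Fin m) (Fin m) ℝ) :=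
  inferInstanceAs (BorelSpace (Fin m → Fin m → ℝ))

lemma betaMeasure_apply (m : ℕ) (μ ν : ℝ) {S : Set (Matrix (Fin m) (Fin m) ℝ)}
    (hS : MeasurableSet S) :
    betaMeasure m μ ν S = ∫⁻ c, S.indicator (betaWeight (μ - ((m : ℝ) + 1) / 2)
      (ν - ((m : ℝ) + 1) / 2) (BOmega m μ ν)) (toSym m c) := by
  have hK := (isClosed_setOf_posSemidef_and_one_sub (n := Fin m)).measurableSet
  rw [betaMeasure, withDensity_apply _ hS, ← lintegral_indicator hS,
    ← lintegral_indicator hK, symMeasure, lintegral_map _ (continuous_toSym m).measurable]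
  · refine lintegral_congr fun c => ?_
    rw [Set.indicator_indicator, Set.inter_comm, ← Set.indicator_indicator]
    rfl
  · rw [Set.indicator_indicator, Set.inter_comm, ← Set.indicator_indicator]
    exact (measurable_betaWeight_comp _ _ _ continuous_id).indicator hS

lemma GammaOmegaR_succ (m : ℕ) (μ : ℝ) :
    GammaOmegaR (m + 1) μ =
      GammaOmegaR m μ * (Real.pi ^ ((m : ℝ) / 2) * Real.Gamma (μ - m / 2)) := by
  rw [GammaOmegaR, GammaOmegaR, Finset.prod_range_succ]
  have h : (((m + 1) * (m + 1 - 1) : ℕ) : ℝ) / 4 = ((m * (m - 1) : ℕ) : ℝ) / 4 + m / 2 := by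
    cases m with
    | zero => simp
    | succ k =>
      push_cast [Nat.add_sub_cancel]
      ring
  rw [h, Real.rpow_add Real.pi_pos]
  ring

lemma GammaOmegaR_pos {m : ℕ} {μ : ℝ} (h : ((m : ℝ) - 1) / 2 < μ) : 0 < GammaOmegaR m μ := by
  refine mul_pos (Real.rpow_pos_of_pos Real.pi_pos _) (Finset.prod_pos fun j hj => ?_)
  have : (j : ℝ) + 1 ≤ m := mod_cast Finset.mem_range.1 hj
  exact Real.Gamma_pos_of_pos (by linarith)

lemma BOmega_pos {m : ℕ} {μ ν : ℝ} (hμ : ((m : ℝ) - 1) / 2 < μ) (hν : ((m : ℝ) - 1) / 2 < ν)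
    (hμν : ((m : ℝ) - 1) / 2 < μ + ν) : 0 < BOmega m μ ν :=
  div_pos (mul_pos (GammaOmegaR_pos hμ) (GammaOmegaR_pos hν)) (GammaOmegaR_pos hμν)

lemma BOmega_succ (m : ℕ) (μ ν : ℝ) :
    BOmega (m + 1) μ ν = BOmega m μ ν * (Real.pi ^ ((m : ℝ) / 2) * Real.Gamma (μ - m / 2) *
      Real.Gamma (ν - m / 2) / Real.Gamma (μ + ν - m / 2)) := by
  have h : (Real.pi ^ ((m : ℝ) / 2)) ≠ 0 := (Real.rpow_pos_of_pos Real.pi_pos _).ne'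
  rw [BOmega, BOmega, GammaOmegaR_succ, GammaOmegaR_succ, GammaOmegaR_succ]
  field_simp

lemma lintegral_betaWeight_border {m : ℕ} {μ ν : ℝ} (hμ : (m : ℝ) / 2 < μ) (hν : (m : ℝ) / 2 < ν)
    {A : Matrix (Fin m) (Fin m) ℝ} (hA : A.det ≠ 0) (hA' : (1 - A).det ≠ 0) :
    ∫⁻ z : (Fin m → ℝ) × ℝ, betaWeight (μ - (((m + 1 : ℕ) : ℝ) + 1) / 2)
        (ν - (((m + 1 : ℕ) : ℝ) + 1) / 2) (BOmega (m + 1) μ ν) (border A z.1 z.2) =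
      betaWeight (μ - ((m : ℝ) + 1) / 2) (ν - ((m : ℝ) + 1) / 2) (BOmega m μ ν) A := by
  have hm := Nat.cast_nonneg (α := ℝ) m
  by_cases h : A.PosSemidef ∧ (1 - A).PosSemidef
  · have hP := h.1.posDef_iff_det_ne_zero.2 hA
    have hP' := h.2.posDef_iff_det_ne_zero.2 hA'
    have hB' : 0 < BOmega (m + 1) μ ν :=
      BOmega_pos (by push_cast; linarith) (by push_cast; linarith) (by push_cast; linarith)
    rw [Measure.volume_eq_prod, lintegral_prod _ (measurable_betaWeight_comp _ _ _
      (continuous_border continuous_const continuous_fst continuous_snd)).aemeasurable]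
    obtain ⟨α, hα⟩ : ∃ α, α = μ - (((m + 1 : ℕ) : ℝ) + 1) / 2 := ⟨_, rfl⟩
    obtain ⟨β, hβ⟩ : ∃ β, β = ν - (((m + 1 : ℕ) : ℝ) + 1) / 2 := ⟨_, rfl⟩
    have hα0 : 0 < α + 1 := by rw [hα]; push_cast; linarith
    have hβ0 : 0 < β + 1 := by rw [hβ]; push_cast; linarith
    rw [← hα, ← hβ]
    have mG := measurable_truncPow
    have inner (b : Fin m → ℝ) :
        ∫⁻ d, betaWeight α β (BOmega (m + 1) μ ν) (border A b d) =
          ENNReal.ofReal (A.det ^ α * (1 - A).det ^ β / BOmega (m + 1) μ ν *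
            ProbabilityTheory.beta (α + 1) (β + 1)) *
            truncPow (α + β + 1) (1 - b ⬝ᵥ (A⁻¹ + (1 - A)⁻¹) *ᵥ b) := by
      have hae : ∀ᵐ d : ℝ, betaWeight α β (BOmega (m + 1) μ ν) (border A b d) =
          ENNReal.ofReal (A.det ^ α * (1 - A).det ^ β / BOmega (m + 1) μ ν) *
            (truncPow α (d - b ⬝ᵥ A⁻¹ *ᵥ b) *
              truncPow β (1 - b ⬝ᵥ (1 - A)⁻¹ *ᵥ b - d)) := by
        filter_upwards [Measure.ae_ne volume (b ⬝ᵥ A⁻¹ *ᵥ b),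
          Measure.ae_ne volume (1 - b ⬝ᵥ (1 - A)⁻¹ *ᵥ b)] with d h1 h2
        exact betaWeight_border hP hP' hB' h1 h2
      have hd := hP.det_pos
      have hd' := hP'.det_pos
      rw [lintegral_congr_ae hae, lintegral_const_mul _ (by fun_prop),
        lintegral_truncPow_mul_truncPow hα0 hβ0, ← mul_assoc, ← ENNReal.ofReal_mul (by positivity),
        add_mulVec, dotProduct_add]
      congr 2
      ring
    have hd := hP.det_pos
    have hd' := hP'.det_pos
    have hbeta := ProbabilityTheory.beta_pos hα0 hβ0
    simp_rw [inner]
    rw [lintegral_const_mul _ (by fun_prop), lintegral_truncPow_sub_quadratic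
      (posDef_inv_add_inv hP hP') (by linarith), truncPow_of_pos one_pos, Real.one_rpow,
      ENNReal.ofReal_one, mul_one, ← ENNReal.ofReal_mul (by positivity),
      det_inv_add_inv_one_sub hP hP', betaWeight, Set.indicator_of_mem (by exact h), BOmega_succ,
      show μ - ((m : ℝ) + 1) / 2 = α + 1 / 2 by rw [hα]; push_cast; ring,
      show ν - ((m : ℝ) + 1) / 2 = β + 1 / 2 by rw [hβ]; push_cast; ring,
      show μ - (m : ℝ) / 2 = α + 1 by rw [hα]; push_cast; ring,
      show ν - (m : ℝ) / 2 = β + 1 by rw [hβ]; push_cast; ring,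
      show μ + ν - (m : ℝ) / 2 = α + β + 1 + 1 + m / 2 by rw [hα, hβ]; push_cast; ring,
      ProbabilityTheory.beta, show α + 1 + (β + 1) = α + β + 1 + 1 by ring,
      Real.sqrt_inv, inv_inv, Real.sqrt_mul hd.le, Real.rpow_add hd, Real.rpow_add hd',
      ← Real.sqrt_eq_rpow, ← Real.sqrt_eq_rpow]
    congr 1
    have g1 := (Real.Gamma_pos_of_pos hα0).ne'
    have g2 := (Real.Gamma_pos_of_pos hβ0).ne'
    have g3 := (Real.Gamma_pos_of_pos (show 0 < α + β + 1 + 1 by linarith)).ne'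
    have g4 := (Real.Gamma_pos_of_pos (show 0 < α + β + 1 + 1 + m / 2 by linarith)).ne'
    have g5 := (Real.rpow_pos_of_pos Real.pi_pos ((m : ℝ) / 2)).ne'
    generalize Real.Gamma (α + 1) = x1 at *
    generalize Real.Gamma (β + 1) = x2 at *
    generalize Real.Gamma (α + β + 1 + 1) = x3 at *
    generalize Real.Gamma (α + β + 1 + 1 + m / 2) = x4 at *
    generalize Real.pi ^ ((m : ℝ) / 2) = x5 at *
    field_simp
  · rw [betaWeight, Set.indicator_of_notMem (by exact h)]
    refine lintegral_eq_zero_of_ae_eq_zero (.of_forall fun z => Set.indicator_of_notMem ?_ _)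
    rintro ⟨h1, h2⟩
    rw [one_sub_border] at h2
    exact h ⟨h1.submatrix Sum.inl, h2.submatrix Sum.inl⟩

lemma measurable_submatrix_castLE {p q : ℕ} (h : q ≤ p) :
    Measurable fun y : Matrix (Fin p) (Fin p) ℝ => y.submatrix (Fin.castLE h) (Fin.castLE h) :=
  (continuous_id.matrix_submatrix _ _).measurable

lemma map_betaMeasure_succ {m : ℕ} {μ ν : ℝ} (hμ : (m : ℝ) / 2 < μ) (hν : (m : ℝ) / 2 < ν) :
    Measure.map (fun y : Matrix (Fin (m + 1)) (Fin (m + 1)) ℝ =>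
        y.submatrix (Fin.castLE m.le_succ) (Fin.castLE m.le_succ)) (betaMeasure (m + 1) μ ν) =
      betaMeasure m μ ν := by
  ext S hS
  have hmeas := measurable_submatrix_castLE m.le_succ
  have hS' : MeasurableSet (toSym m ⁻¹' S) := (continuous_toSym m).measurable hS
  rw [Measure.map_apply hmeas hS, betaMeasure_apply _ _ _ (hmeas hS), betaMeasure_apply _ _ _ hS]
  set w := betaWeight (n := Fin m ⊕ Unit) (μ - (((m + 1 : ℕ) : ℝ) + 1) / 2)
    (ν - (((m + 1 : ℕ) : ℝ) + 1) / 2) (BOmega (m + 1) μ ν) with hw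
  have hF : Measurable fun x : (SymIdx m → ℝ) × ((Fin m → ℝ) × ℝ) =>
      (toSym m ⁻¹' S).indicator 1 x.1 * w (border (toSym m x.1) x.2.1 x.2.2) := by
    refine (((measurable_one.indicator hS').comp measurable_fst).mul
      (measurable_betaWeight_comp _ _ _ (continuous_border ?_ ?_ ?_)))
    · exact (continuous_toSym m).comp continuous_fst
    · fun_prop
    · fun_prop
  have hcongr (c : SymIdx (m + 1) → ℝ) :
      ((fun y : Matrix (Fin (m + 1)) (Fin (m + 1)) ℝ =>
        y.submatrix (Fin.castLE m.le_succ) (Fin.castLE m.le_succ)) ⁻¹' S).indicator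
        (betaWeight (μ - (((m + 1 : ℕ) : ℝ) + 1) / 2) (ν - (((m + 1 : ℕ) : ℝ) + 1) / 2)
          (BOmega (m + 1) μ ν)) (toSym (m + 1) c) =
      (fun x : (SymIdx m → ℝ) × ((Fin m → ℝ) × ℝ) =>
        (toSym m ⁻¹' S).indicator 1 x.1 * w (border (toSym m x.1) x.2.1 x.2.2))
        (splitCoords m c) := by
    have hcorner : (toSym (m + 1) c).submatrix (Fin.castLE m.le_succ) (Fin.castLE m.le_succ) =
        toSym m (splitCoords m c).1 := by
      have hcomp : finSumUnitEquiv m ∘ Sum.inl = Fin.castLE m.le_succ := by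
        ext i
        simp [finSumUnitEquiv]
      rw [← hcomp, ← submatrix_submatrix, toSym_succ_submatrix, border_submatrix_inl]
    simp only [hw, ← toSym_succ_submatrix, betaWeight_submatrix_equiv]
    by_cases hc : toSym m (splitCoords m c).1 ∈ S
    · rw [Set.indicator_of_mem (by rwa [Set.mem_preimage, hcorner]), Set.indicator_of_mem (by exact hc)]
      simp
    · rw [Set.indicator_of_notMem (by rwa [Set.mem_preimage, hcorner]),
        Set.indicator_of_notMem (by exact hc)]
      simp
  simp_rw [hcongr]
  rw [(measurePreserving_splitCoords m).lintegral_comp hF, Measure.volume_eq_prod,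
    lintegral_prod _ hF.aemeasurable]
  refine lintegral_congr_ae ?_
  filter_upwards [ae_det_toSym_ne_zero m] with a ha
  rw [lintegral_const_mul _ (measurable_betaWeight_comp _ _ _
    (continuous_border continuous_const continuous_fst continuous_snd)),
    lintegral_betaWeight_border hμ hν ha.1 ha.2]
  by_cases h : toSym m a ∈ S
  · rw [Set.indicator_of_mem h, Set.indicator_of_mem (by exact h)]
    simp
  · rw [Set.indicator_of_notMem h, Set.indicator_of_notMem (by exact h)]
    simp

end Measure

/-- For `μ, ν > (p̃−1)/2` and `1 ≤ q ≤ p̃`, the pushforward of the matrix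
beta distribution `β_{p̃;μ,ν}` under the upper-left `q×q` corner map is `β_{q;μ,ν}`. -/
theorem stmt10 (p q : ℕ) (hq : 1 ≤ q) (hqp : q ≤ p) (μ ν : ℝ)
    (hμ : ((p : ℝ) - 1) / 2 < μ) (hν : ((p : ℝ) - 1) / 2 < ν) :
    Measure.map
        (fun y : Matrix (Fin p) (Fin p) ℝ =>
          y.submatrix (Fin.castLE hqp) (Fin.castLE hqp))
        (betaMeasure p μ ν)
      = betaMeasure q μ ν := by
  induction p, hqp using Nat.le_induction with
  | base =>
    have : (fun y : Matrix (Fin q) (Fin q) ℝ =>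
        y.submatrix (Fin.castLE le_rfl) (Fin.castLE le_rfl)) = id := rfl
    rw [this, Measure.map_id]
  | succ m hqm ih =>
    push_cast at hμ hν
    have ih' := ih (by linarith) (by linarith)
    rw [← map_betaMeasure_succ (m := m) (by linarith) (by linarith),
      Measure.map_map (measurable_submatrix_castLE hqm) (measurable_submatrix_castLE _)] at ih'
    exact ih'
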